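/- Let (f₁,…,f_N; p₁,…,p_N) be an admissible iterated function system with unique invariant measure μ* on (0,1), and let φ : [0,1] → ℝ be Lipschitz with ∫ φ dμ* = 0. Then there exists a constant C > 0 such that ‖ Σ_{j=1}^n Uʲφ ‖_{L²(μ*)} ≤ C n^{3/8} for all n ∈ ℕ; in particular the Maxwell–Woodroofe condition Σ_{n=1}^∞ n^{−3/2} ‖ Σ_{j=1}^n Uʲφ ‖_{L²(μ*)} < ∞ holds. -/

import Mathlib

open Set MeasureTheory Finset Filter

/-- An admissible iterated function system on `[0,1]`: increasing homeomorphisms of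
`[0,1]` fixing the endpoints, `C¹` near the endpoints with positive derivatives
`d i` at `0` and `e i` at `1`, positive probabilities, positive Lyapunov exponents at
both endpoints, and at every interior point some map moves it left and some right. -/
structure AdmissibleIFS (N : ℕ) (f : Fin N → ℝ → ℝ) (p d e : Fin N → ℝ) : Prop where
  meas : ∀ i, Measurable (f i)
  mono : ∀ i, StrictMonoOn (f i) (Icc 0 1)
  maps : ∀ i, MapsTo (f i) (Icc 0 1) (Icc 0 1)
  cont : ∀ i, ContinuousOn (f i) (Icc 0 1)
  surj : ∀ i, SurjOn (f i) (Icc 0 1) (Icc 0 1)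
  fix0 : ∀ i, f i 0 = 0
  fix1 : ∀ i, f i 1 = 1
  ppos : ∀ i, 0 < p i
  psum : ∑ i, p i = 1
  c1 : ∀ i, ∃ η > (0:ℝ), ContDiffOn ℝ 1 (f i) (Icc 0 η) ∧ ContDiffOn ℝ 1 (f i) (Icc (1 - η) 1)
  deriv0 : ∀ i, HasDerivWithinAt (f i) (d i) (Icc 0 1) 0
  deriv1 : ∀ i, HasDerivWithinAt (f i) (e i) (Icc 0 1) 1
  dpos : ∀ i, 0 < d i
  epos : ∀ i, 0 < e i
  lyap0 : 0 < ∑ i, p i * Real.log (d i)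
  lyap1 : 0 < ∑ i, p i * Real.log (e i)
  interior : ∀ x ∈ Ioo (0:ℝ) 1, (∃ i, f i x < x) ∧ (∃ j, x < f j x)

/-- Iterates along a sequence of indices: `wordIter f ω n = f_{ω (n-1)} ∘ ⋯ ∘ f_{ω 0}`. -/
def wordIter {N : ℕ} (f : Fin N → ℝ → ℝ) (ω : ℕ → Fin N) : ℕ → ℝ → ℝ
  | 0 => id
  | n + 1 => f (ω n) ∘ wordIter f ω n

/-- `⌊n^{1/4}⌋`. -/
noncomputable def nroot4 (n : ℕ) : ℕ := ⌊(n : ℝ) ^ ((1 : ℝ) / 4)⌋₊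

/-- The transfer (dual) operator `Uφ(x) = ∑ i, p i * φ (f i x)`. -/
def transferOp {N : ℕ} (f : Fin N → ℝ → ℝ) (p : Fin N → ℝ) (φ : ℝ → ℝ) : ℝ → ℝ :=
  fun x => ∑ i, p i * φ (f i x)


/-- generic averaging operator -/
def avgOp {ι X : Type*} [Fintype ι] (p : ι → ℝ) (F : ι → X → X) (g : X → ℝ) : X → ℝ :=
  fun x => ∑ i, p i * g (F i x)

section avg
variable {ι X : Type*} [Fintype ι] {p : ι → ℝ} {F : ι → X → X} {S : Set X}

lemma avgOp_mono (hp : ∀ i, 0 ≤ p i) (hS : ∀ i, ∀ x ∈ S, F i x ∈ S) {g h : X → ℝ}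
    (hgh : ∀ x ∈ S, g x ≤ h x) : ∀ x ∈ S, avgOp p F g x ≤ avgOp p F h x := by
  intro x hx
  exact Finset.sum_le_sum fun i _ => mul_le_mul_of_nonneg_left (hgh _ (hS i x hx)) (hp i)

lemma avgOp_iter_mono (hp : ∀ i, 0 ≤ p i) (hS : ∀ i, ∀ x ∈ S, F i x ∈ S) {g h : X → ℝ}
    (hgh : ∀ x ∈ S, g x ≤ h x) (n : ℕ) :
    ∀ x ∈ S, (avgOp p F)^[n] g x ≤ (avgOp p F)^[n] h x := by
  induction n with
  | zero => simpa using hgh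
  | succ n ih =>
    simp only [Function.iterate_succ_apply']
    exact avgOp_mono hp hS ih

lemma avgOp_lin (a b : ℝ) (g h : X → ℝ) :
    avgOp p F (fun x => a * g x + b * h x) =
      fun x => a * avgOp p F g x + b * avgOp p F h x := by
  funext x
  simp only [avgOp, Finset.mul_sum, ← Finset.sum_add_distrib]
  exact Finset.sum_congr rfl fun i _ => by ring

lemma avgOp_iter_lin (a b : ℝ) (g h : X → ℝ) (n : ℕ) :
    (avgOp p F)^[n] (fun x => a * g x + b * h x) =
      fun x => a * (avgOp p F)^[n] g x + b * (avgOp p F)^[n] h x := by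
  induction n with
  | zero => rfl
  | succ n ih => simp only [Function.iterate_succ_apply', ih, avgOp_lin]

lemma avgOp_const (hp1 : ∑ i, p i = 1) (c : ℝ) : avgOp p F (fun _ => c) = fun _ => c := by
  funext x
  simp only [avgOp, ← Finset.sum_mul, hp1, one_mul]

lemma avgOp_iter_const (hp1 : ∑ i, p i = 1) (c : ℝ) (n : ℕ) :
    (avgOp p F)^[n] (fun _ => c) = fun _ => c := by
  induction n with
  | zero => rfl
  | succ n ih => rw [Function.iterate_succ_apply', ih, avgOp_const hp1]

lemma avgOp_drift (hp : ∀ i, 0 ≤ p i) (hp1 : ∑ i, p i = 1)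
    (hS : ∀ i, ∀ x ∈ S, F i x ∈ S) {V : X → ℝ} {l K : ℝ} (hl : 0 ≤ l) (hl1 : l < 1)
    (hK : 0 ≤ K) (hV : ∀ x ∈ S, 0 ≤ V x)
    (hd : ∀ x ∈ S, avgOp p F V x ≤ l * V x + K) (n : ℕ) :
    ∀ x ∈ S, (avgOp p F)^[n+1] V x ≤ l * V x + K / (1 - l) := by
  have h1 : 0 < 1 - l := by linarith
  have hKK : l * (K / (1 - l)) + K = K / (1 - l) := by field_simp; ring
  induction n with
  | zero =>
    intro x hx
    have := hd x hx
    have : K ≤ K / (1 - l) := by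
      have : 0 ≤ K / (1 - l) := by positivity
      nlinarith
    simp; linarith [hd x hx]
  | succ n ih =>
    intro x hx
    rw [Function.iterate_succ_apply]
    have h2 := avgOp_iter_mono (p := p) hp hS hd (n + 1) x hx
    have h3 := avgOp_iter_lin (p := p) (F := F) l 1 V (fun _ => K) (n + 1)
    rw [avgOp_iter_const hp1] at h3
    simp only [one_mul] at h3
    rw [h3] at h2
    have h4 := mul_le_mul_of_nonneg_left (ih x hx) hl
    have h5 : 0 ≤ V x := hV x hx
    nlinarith [mul_nonneg (mul_nonneg hl h5) h1.le]

end avg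

lemma contraction_abs {ι X : Type*} [Fintype ι] {p : ι → ℝ} {F : ι → X → X} {S A : Set X}
    (hp : ∀ i, 0 ≤ p i) (hp1 : ∑ i, p i = 1)
    (hS : ∀ i, ∀ x ∈ S, F i x ∈ S) {V : X → ℝ} {l K : ℝ} (hl : 0 < l) (hl1 : l < 1)
    (hK : 0 < K) (hV : ∀ x ∈ S, 0 ≤ V x)
    (hd : ∀ x ∈ S, avgOp p F V x ≤ l * V x + K)
    (D : ℕ → X → ℝ) (hD : ∀ n, D (n+1) = avgOp p F (D n))
    (hDA : ∀ n, ∀ x ∈ S, x ∈ A → D n x ≤ 0) (hD1 : ∀ n, ∀ x ∈ S, D n x ≤ 1)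
    (hsplit : ∀ R : ℝ, ∃ m : ℕ, ∃ ε > (0:ℝ), ∀ x ∈ S, V x ≤ R →
      ε ≤ (avgOp p F)^[m+1] (A.indicator (fun _ => (1:ℝ))) x) :
    ∃ C > (0:ℝ), ∃ s : ℝ, 0 < s ∧ s < 1 ∧ ∀ n, ∀ x ∈ S, D n x ≤ C * s ^ n * (1 + V x) := by
  have h1 : 0 < 1 - l := by linarith
  set K' := K / (1 - l) with hK'
  have hK'0 : 0 < K' := by positivity
  set R := 4 * K' / (1 - l) with hR
  have hRR : (1 - l) * R = 4 * K' := by rw [hR]; field_simp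
  have hR0 : 0 < R := by positivity
  obtain ⟨m, ε, hε, hs⟩ := hsplit R
  have hdm := avgOp_drift hp hp1 hS hl.le hl1 hK.le hV hd m
  set β := ε / (2 * K') with hβ
  have hβ0 : 0 < β := by positivity
  have hβK : β * K' = ε / 2 := by rw [hβ]; field_simp
  -- indicator iterate is nonnegative
  have hind0 : ∀ x ∈ S, 0 ≤ (avgOp p F)^[m+1] (A.indicator (fun _ => (1:ℝ))) x := by
    intro x hx
    have := avgOp_iter_mono (p := p) (F := F) hp hS (g := fun _ => (0:ℝ))
      (h := A.indicator (fun _ => (1:ℝ)))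
      (fun x _ => Set.indicator_nonneg (fun _ _ => zero_le_one) x) (m+1) x hx
    rwa [avgOp_iter_const hp1] at this
  obtain ⟨ρ, hρ0, hρ1, hρl, hρε, hρR⟩ : ∃ ρ : ℝ, 0 < ρ ∧ ρ < 1 ∧ (1 + l) / 2 ≤ ρ ∧ 1 - ε / 2 ≤ ρ ∧
      (1 - ρ) ≤ β * (K') := by
    refine ⟨max ((1 + l) / 2) (max (1 - ε / 2) (1 - β * K')), ?_, ?_, le_max_left _ _,
      (le_max_left _ _).trans (le_max_right _ _), ?_⟩
    · exact lt_of_lt_of_le (by linarith) (le_max_left _ _)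
    · refine max_lt (by linarith) (max_lt (by linarith) (by nlinarith [mul_pos hβ0 hK'0]))
    · have : 1 - β * K' ≤ max ((1 + l) / 2) (max (1 - ε / 2) (1 - β * K')) :=
        (le_max_right _ _).trans (le_max_right _ _)
      linarith
  have key : ∀ x ∈ S, 1 - (avgOp p F)^[m+1] (A.indicator (fun _ => (1:ℝ))) x
      + β * (avgOp p F)^[m+1] V x ≤ ρ * (1 + β * V x) := by
    intro x hx
    have a1 := mul_le_mul_of_nonneg_left (hdm x hx) hβ0.le
    have a2 := hV x hx
    have a5 := hind0 x hx
    have a6 : 0 ≤ β * V x := by positivity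
    have a7 : 0 ≤ (ρ - (1 + l) / 2) * (β * V x) := mul_nonneg (by linarith) a6
    by_cases hx' : V x ≤ R
    · have a3 := hs x hx hx'
      nlinarith
    · push Not at hx'
      have a8 : β * ((1 - l) * R) ≤ β * ((1 - l) * V x) := by gcongr
      rw [hRR] at a8
      nlinarith
  have main : ∀ k r : ℕ, ∀ x ∈ S,
      D (k * (m+1) + r) x ≤ ρ ^ k * ((1 - A.indicator (fun _ => (1:ℝ)) x) + β * V x) := by
    intro k
    induction k with
    | zero =>
      intro r x hx
      have a2 := hV x hx
      have a6 : 0 ≤ β * V x := by positivity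
      simp only [zero_mul, zero_add, pow_zero, one_mul]
      by_cases hA : x ∈ A
      · simp only [hA, Set.indicator_of_mem]; linarith [hDA r x hx hA]
      · simp only [hA, not_false_eq_true, Set.indicator_of_notMem]; linarith [hD1 r x hx]
    | succ k ih =>
      intro r x hx
      have a2 := hV x hx
      have a6 : 0 ≤ β * V x := by positivity
      by_cases hA : x ∈ A
      · simp only [hA, Set.indicator_of_mem]
        have := hDA ((k + 1) * (m + 1) + r) x hx hA
        have : 0 ≤ ρ ^ (k+1) * (1 - 1 + β * V x) := by
          apply mul_nonneg (by positivity); linarith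
        linarith
      · simp only [hA, not_false_eq_true, Set.indicator_of_notMem]
        have hit : ∀ q n, D (n + q) = (avgOp p F)^[q] (D n) := by
          intro q n
          induction q with
          | zero => rfl
          | succ q ihq => rw [← add_assoc, hD, ihq, Function.iterate_succ_apply']
        have e1 : (k + 1) * (m + 1) + r = (k * (m + 1) + r) + (m + 1) := by ring
        rw [e1, hit]
        have b1 := avgOp_iter_mono (p := p) (F := F) hp hS (ih r) (m+1) x hx
        have e2 : (fun x => ρ ^ k * ((1 - A.indicator (fun _ => (1:ℝ)) x) + β * V x)) =
            fun x => ρ ^ k * (fun x => 1 * (fun x => 1 * (fun _ => (1:ℝ)) x +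
              (-1) * A.indicator (fun _ => (1:ℝ)) x) x + β * V x) x + 0 * (fun _ => (0:ℝ)) x := by
          funext x; ring
        rw [e2, avgOp_iter_lin, avgOp_iter_lin, avgOp_iter_lin, avgOp_iter_const hp1] at b1
        have b2 := mul_le_mul_of_nonneg_left (key x hx) (pow_nonneg hρ0.le k)
        rw [pow_succ]
        simp only at b1
        nlinarith
  -- convert
  set s := ρ ^ ((1:ℝ) / ((m+1 : ℕ) : ℝ)) with hs'
  have hs0 : 0 < s := Real.rpow_pos_of_pos hρ0 _
  have hs1 : s < 1 := Real.rpow_lt_one hρ0.le hρ1 (by positivity)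
  have hsm : s ^ (m+1) = ρ := by
    rw [hs', ← Real.rpow_natCast, ← Real.rpow_mul hρ0.le]
    rw [one_div, inv_mul_cancel₀ (by positivity), Real.rpow_one]
  refine ⟨ρ⁻¹ * (1 + β), by positivity, s, hs0, hs1, fun n x hx => ?_⟩
  have b := main (n / (m+1)) (n % (m+1)) x hx
  rw [Nat.div_add_mod' n (m+1)] at b
  have a2 := hV x hx
  have c1 : ρ ^ (n / (m+1)) ≤ ρ⁻¹ * s ^ n := by
    rw [← hsm, ← pow_mul]
    rw [le_inv_mul_iff₀ (by positivity), ← pow_add]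
    apply pow_le_pow_of_le_one hs0.le hs1.le
    have := Nat.div_add_mod n (m+1)
    have := Nat.mod_lt n (Nat.succ_pos m)
    lia
  have c2 : (1 - A.indicator (fun _ => (1:ℝ)) x) + β * V x ≤ (1 + β) * (1 + V x) := by
    have : 0 ≤ A.indicator (fun _ => (1:ℝ)) x := Set.indicator_nonneg (fun _ _ => zero_le_one) x
    nlinarith
  calc D n x ≤ _ := b
    _ ≤ ρ ^ (n / (m+1)) * ((1 + β) * (1 + V x)) := by gcongr
    _ ≤ (ρ⁻¹ * s ^ n) * ((1 + β) * (1 + V x)) := by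
      apply mul_le_mul_of_nonneg_right c1; positivity
    _ = _ := by ring

lemma drift_one {N : ℕ} (f : Fin N → ℝ → ℝ) (p d : Fin N → ℝ)
    (hp : ∀ i, 0 ≤ p i) (hp1 : ∑ i, p i = 1)
    (hpos : ∀ i, ∀ x ∈ Set.Ioo (0:ℝ) 1, 0 < f i x)
    (hmono : ∀ i, MonotoneOn (f i) (Set.Icc 0 1)) (h0 : ∀ i, f i 0 = 0)
    (hder : ∀ i, HasDerivWithinAt (f i) (d i) (Set.Icc 0 1) 0)
    (hd : ∀ i, 0 < d i) (hly : 0 < ∑ i, p i * Real.log (d i)) :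
    ∃ α > (0:ℝ), ∃ l K : ℝ, 0 < l ∧ l < 1 ∧ 0 < K ∧ ∀ x ∈ Set.Ioo (0:ℝ) 1,
      ∑ i, p i * (f i x) ^ (-α) ≤ l * x ^ (-α) + K := by
  have hA : ∃ α > (0:ℝ), ∑ i, p i * (d i) ^ (-α) < 1 := by
    have hdv : HasDerivAt (fun a : ℝ => ∑ i, p i * (d i) ^ (-a))
        (∑ i, p i * (-Real.log (d i))) 0 := by
      apply HasDerivAt.fun_sum
      intro i _
      have := ((hasDerivAt_neg (0:ℝ)).const_rpow (hd i)).const_mul (p i)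
      simpa using this
    have hneg : ∑ i, p i * (-Real.log (d i)) < 0 := by
      simp only [mul_neg, Finset.sum_neg_distrib]; linarith
    have hv0 : ∑ i, p i * (d i) ^ (-(0:ℝ)) = 1 := by simp [hp1]
    have h1 := (hasDerivAt_iff_tendsto_slope.1 hdv).eventually (gt_mem_nhds hneg)
    have h2 : ∀ᶠ a in nhdsWithin (0:ℝ) (Set.Ioi 0), slope (fun a : ℝ => ∑ i, p i * (d i) ^ (-a)) 0 a < 0 :=
      h1.filter_mono (nhdsWithin_mono _ fun x hx => ne_of_gt hx)
    obtain ⟨a, ha, ha0⟩ := (h2.and self_mem_nhdsWithin).exists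
    have ha0 : 0 < a := ha0
    refine ⟨a, ha0, ?_⟩
    rw [slope_def_field, hv0] at ha
    have := (div_neg_iff.1 ha)
    rcases this with h | h <;> linarith [h.1, h.2]
  obtain ⟨α, hα, hlt⟩ := hA
  have ht : ∀ i, Tendsto (fun x => f i x / x) (nhdsWithin 0 (Set.Ioo (0:ℝ) 1)) (nhds (d i)) := by
    intro i
    have := hasDerivWithinAt_iff_tendsto_slope.1 (hder i)
    have h3 := this.mono_left (nhdsWithin_mono (0:ℝ) (s := Set.Ioo (0:ℝ) 1)
      (fun x hx => ⟨⟨hx.1.le, hx.2.le⟩, ne_of_gt hx.1⟩))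
    refine h3.congr fun x => ?_
    simp [slope_def_field, h0]
  have ht2 : Tendsto (fun x => ∑ i, p i * (f i x / x) ^ (-α)) (nhdsWithin 0 (Set.Ioo (0:ℝ) 1))
      (nhds (∑ i, p i * (d i) ^ (-α))) := by
    apply tendsto_finsetSum
    intro i _
    exact ((ht i).rpow_const (Or.inl (hd i).ne')).const_mul _
  have hs0 : 0 ≤ ∑ i, p i * (d i) ^ (-α) :=
    Finset.sum_nonneg fun i _ => mul_nonneg (hp i) (Real.rpow_nonneg (hd i).le _)
  obtain ⟨l, hl, hl1⟩ := exists_between hlt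
  have he := ht2.eventually (gt_mem_nhds hl)
  rw [nhdsWithin_Ioo_eq_nhdsGT (by norm_num)] at he
  obtain ⟨u, hu, hu'⟩ := mem_nhdsGT_iff_exists_Ioo_subset.1 he
  have hu : 0 < u := hu
  set x0 := min (u/2) (1/2) with hx0
  have hx00 : 0 < x0 := by positivity
  have hx01 : x0 ≤ 1/2 := min_le_right _ _
  have hx0u : x0 ≤ u/2 := min_le_left _ _
  have hf0 : ∀ i, 0 < f i x0 := fun i => hpos i x0 ⟨hx00, by linarith⟩
  have hKn : 0 ≤ ∑ i, p i * (f i x0) ^ (-α) :=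
    Finset.sum_nonneg fun i _ => mul_nonneg (hp i) (Real.rpow_nonneg (hf0 i).le _)
  refine ⟨α, hα, l, ∑ i, p i * (f i x0) ^ (-α) + 1, by linarith, hl1, by linarith, ?_⟩
  intro x hx
  have hxp : 0 < x ^ (-α) := Real.rpow_pos_of_pos hx.1 _
  by_cases hxx : x < x0
  · have h5 : ∑ i, p i * (f i x / x) ^ (-α) < l := hu' ⟨hx.1, by linarith⟩
    have h6 : ∑ i, p i * (f i x) ^ (-α) = (∑ i, p i * (f i x / x) ^ (-α)) * x ^ (-α) := by
      rw [Finset.sum_mul]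
      refine Finset.sum_congr rfl fun i _ => ?_
      rw [mul_assoc, ← Real.mul_rpow (div_nonneg (hpos i x hx).le hx.1.le) hx.1.le,
        div_mul_cancel₀ _ hx.1.ne']
    rw [h6]
    nlinarith
  · push Not at hxx
    have : ∑ i, p i * (f i x) ^ (-α) ≤ ∑ i, p i * (f i x0) ^ (-α) := by
      refine Finset.sum_le_sum fun i _ => mul_le_mul_of_nonneg_left ?_ (hp i)
      apply Real.rpow_le_rpow_of_nonpos (hf0 i) _ (by linarith)
      exact hmono i ⟨hx00.le, by linarith⟩ ⟨hx.1.le, hx.2.le⟩ hxx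
    have : 0 < l * x ^ (-α) := by apply mul_pos (by linarith) hxp
    linarith

lemma avgOp_lower {ι X : Type*} [Fintype ι] {p : ι → ℝ} {F : ι → X → X} {S : Set X}
    (hp1 : ∑ i, p i = 1) (hp : ∀ i, 0 ≤ p i)
    (hS : ∀ i, ∀ x ∈ S, F i x ∈ S) {g : X → ℝ} (hg : ∀ x ∈ S, 0 ≤ g x) {q : ℝ} (hq : 0 ≤ q)
    (hqp : ∀ i, q ≤ p i) (G : X → X) (hG : ∀ x, ∃ i, G x = F i x) (m : ℕ) :
    ∀ x ∈ S, q ^ m * g (G^[m] x) ≤ (avgOp p F)^[m] g x := by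
  have hnn : ∀ m : ℕ, ∀ x ∈ S, 0 ≤ (avgOp p F)^[m] g x := by
    intro m x hx
    have := avgOp_iter_mono (p := p) (F := F) hp hS (g := fun _ => (0:ℝ)) hg m x hx
    rwa [avgOp_iter_const hp1] at this
  induction m with
  | zero => intro x hx; simp
  | succ m ih =>
    intro x hx
    obtain ⟨i, hi⟩ := hG x
    rw [Function.iterate_succ_apply, Function.iterate_succ_apply']
    have h1 := ih (F i x) (hS i x hx)
    have h2 : p i * (avgOp p F)^[m] g (F i x) ≤ avgOp p F ((avgOp p F)^[m] g) x :=
      Finset.single_le_sum (f := fun i => p i * (avgOp p F)^[m] g (F i x))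
        (fun j _ => mul_nonneg (hp j) (hnn m _ (hS j x hx))) (Finset.mem_univ i)
    rw [hi]
    have h3 := mul_le_mul_of_nonneg_right (hqp i) (hnn m _ (hS i x hx))
    have h4 := mul_le_mul_of_nonneg_left h1 hq
    rw [pow_succ]
    nlinarith

lemma reach_right (R : ℝ → ℝ) (hR : ContinuousOn R (Set.Icc 0 1))
    (hS : ∀ x ∈ Set.Ioo (0:ℝ) 1, R x ∈ Set.Ioo (0:ℝ) 1) (hlt : ∀ x ∈ Set.Ioo (0:ℝ) 1, x < R x)
    (a : ℝ) (ha : a ∈ Set.Ioo (0:ℝ) 1) :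
    ∀ᶠ m : ℕ in atTop, 1/2 ≤ R^[m] a := by
  have hmem : ∀ m : ℕ, R^[m] a ∈ Set.Ioo (0:ℝ) 1 := by
    intro m
    induction m with
    | zero => simpa using ha
    | succ m ih => rw [Function.iterate_succ_apply']; exact hS _ ih
  have hmono : Monotone fun m : ℕ => R^[m] a := by
    apply monotone_nat_of_le_succ
    intro m
    rw [Function.iterate_succ_apply']; exact (hlt _ (hmem m)).le
  have hbdd : BddAbove (Set.range fun m : ℕ => R^[m] a) := ⟨1, by rintro _ ⟨m, rfl⟩; exact (hmem m).2.le⟩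
  have hlim := tendsto_atTop_ciSup hmono hbdd
  set s := ⨆ m : ℕ, R^[m] a
  have hs0 : a ≤ s := le_ciSup hbdd 0
  have hs1 : s ≤ 1 := ciSup_le fun m => (hmem m).2.le
  have hs : s = 1 := by
    by_contra hne
    have hsm : s ∈ Set.Ioo (0:ℝ) 1 := ⟨by linarith [ha.1], lt_of_le_of_ne hs1 hne⟩
    have hc : ContinuousAt R s := hR.continuousAt (Icc_mem_nhds hsm.1 hsm.2)
    have h1 := hc.tendsto.comp hlim
    have h2 := hlim.comp (tendsto_add_atTop_nat 1)
    have h3 : R s = s := by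
      refine tendsto_nhds_unique h1 (h2.congr fun m => ?_)
      simp [Function.iterate_succ_apply']
    linarith [hlt s hsm]
  rw [hs] at hlim
  exact (hlim.eventually (lt_mem_nhds (show (1/2:ℝ) < 1 by norm_num))).mono fun m h => h.le

lemma reach_left (R : ℝ → ℝ) (hR : ContinuousOn R (Set.Icc 0 1))
    (hS : ∀ x ∈ Set.Ioo (0:ℝ) 1, R x ∈ Set.Ioo (0:ℝ) 1) (hlt : ∀ x ∈ Set.Ioo (0:ℝ) 1, R x < x)
    (a : ℝ) (ha : a ∈ Set.Ioo (0:ℝ) 1) :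
    ∀ᶠ m : ℕ in atTop, R^[m] a ≤ 1/2 := by
  have hit : ∀ m : ℕ, (fun x => 1 - R (1 - x))^[m] (1 - a) = 1 - R^[m] a := by
    intro m
    induction m with
    | zero => rfl
    | succ m ih => simp only [Function.iterate_succ_apply', ih]; simp
  have := reach_right (fun x => 1 - R (1 - x))
    (continuousOn_const.sub (hR.comp (continuousOn_const.sub continuousOn_id)
      (fun x hx => ⟨by simpa using hx.2, by simpa using hx.1⟩)))
    (fun x hx => by
      have := hS (1 - x) ⟨by linarith [hx.2], by linarith [hx.1]⟩
      exact ⟨by linarith [this.2], by linarith [this.1]⟩)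
    (fun x hx => by
      have := hlt (1 - x) ⟨by linarith [hx.2], by linarith [hx.1]⟩
      linarith) (1 - a) ⟨by linarith [ha.2], by linarith [ha.1]⟩
  filter_upwards [this] with m hm
  rw [hit] at hm
  linarith

section adm
variable {N : ℕ} {f : Fin N → ℝ → ℝ} {p d e : Fin N → ℝ}

lemma adm_maps (h : AdmissibleIFS N f p d e) (i : Fin N) :
    ∀ x ∈ Set.Ioo (0:ℝ) 1, f i x ∈ Set.Ioo (0:ℝ) 1 := by
  intro x hx
  have h1 := h.mono i (show (0:ℝ) ∈ Set.Icc (0:ℝ) 1 by simp) ⟨hx.1.le, hx.2.le⟩ hx.1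
  have h2 := h.mono i ⟨hx.1.le, hx.2.le⟩ (show (1:ℝ) ∈ Set.Icc (0:ℝ) 1 by simp) hx.2
  rw [h.fix0] at h1; rw [h.fix1] at h2
  exact ⟨h1, h2⟩

lemma adm_drift (h : AdmissibleIFS N f p d e) :
    ∃ V : ℝ → ℝ, Measurable V ∧ (∀ x ∈ Set.Ioo (0:ℝ) 1, 0 ≤ V x) ∧
      (∃ l K : ℝ, 0 < l ∧ l < 1 ∧ 0 < K ∧ ∀ x ∈ Set.Ioo (0:ℝ) 1,
        transferOp f p V x ≤ l * V x + K) ∧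
      ∀ R : ℝ, ∃ a ∈ Set.Ioo (0:ℝ) 1, ∃ b ∈ Set.Ioo (0:ℝ) 1, ∀ x ∈ Set.Ioo (0:ℝ) 1,
        V x ≤ R → a ≤ x ∧ x ≤ b := by
  have hp := fun i => (h.ppos i).le
  obtain ⟨α, hα, l, K, hl, hl1, hK, H⟩ := drift_one f p d hp h.psum
    (fun i x hx => (adm_maps h i x hx).1) (fun i => (h.mono i).monotoneOn) h.fix0 h.deriv0
    h.dpos h.lyap0
  obtain ⟨α', hα', l', K', hl', hl1', hK', H'⟩ := drift_one (fun i x => 1 - f i (1 - x)) p e hp h.psum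
    (fun i x hx => by
      have := (adm_maps h i (1-x) ⟨by linarith [hx.2], by linarith [hx.1]⟩).2
      linarith)
    (fun i x hx y hy hxy => by
      have := (h.mono i).monotoneOn (a := 1 - y) (b := 1 - x) ⟨by linarith [hy.2], by linarith [hy.1]⟩
        ⟨by linarith [hx.2], by linarith [hx.1]⟩ (by linarith)
      show 1 - f i (1 - x) ≤ 1 - f i (1 - y)
      linarith) (fun i => by simp [h.fix1])
    (fun i => by
      have h1 : HasDerivWithinAt (f i) (e i) (Set.Icc 0 1) ((fun x : ℝ => 1 - x) 0) := by
        simpa using h.deriv1 i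
      have h2 : HasDerivWithinAt (fun x : ℝ => 1 - x) (-1) (Set.Icc 0 1) 0 := by
        simpa using ((hasDerivAt_id (0:ℝ)).const_sub 1).hasDerivWithinAt
      have h3 := (h1.comp 0 h2 (fun x hx => ⟨by linarith [hx.2], by linarith [hx.1]⟩)).const_sub 1
      simpa [Function.comp_def] using h3)
    h.epos h.lyap1
  have hpw : ∀ x ∈ Set.Ioo (0:ℝ) 1, 0 < x ^ (-α) ∧ 0 < (1 - x) ^ (-α') := fun x hx =>
    ⟨Real.rpow_pos_of_pos hx.1 _, Real.rpow_pos_of_pos (by linarith [hx.2]) _⟩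
  refine ⟨fun x => x ^ (-α) + (1 - x) ^ (-α'), by fun_prop, fun x hx => ?_,
    ⟨max l l', K + K', lt_max_of_lt_left hl, max_lt hl1 hl1', by linarith, fun x hx => ?_⟩, fun R => ?_⟩
  · have := hpw x hx; linarith
  · have h1 := H x hx
    have h2 := H' (1 - x) ⟨by linarith [hx.2], by linarith [hx.1]⟩
    simp only [sub_sub_cancel] at h2
    simp only [transferOp, mul_add, Finset.sum_add_distrib]
    have h3 := hpw x hx
    have h4 := mul_le_mul_of_nonneg_right (le_max_left l l') h3.1.le
    have h5 := mul_le_mul_of_nonneg_right (le_max_right l l') h3.2.le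
    linarith
  · set M := max R 2 with hM
    have hM2 : 2 ≤ M := le_max_right _ _
    have hMR : R ≤ M := le_max_left _ _
    have key : ∀ a : ℝ, 0 < a → (M ^ (-(1/a)) ∈ Set.Ioo (0:ℝ) 1) ∧
        ∀ x : ℝ, 0 < x → x ^ (-a) ≤ M → M ^ (-(1/a)) ≤ x := by
      intro a ha
      refine ⟨⟨Real.rpow_pos_of_pos (by linarith) _,
        Real.rpow_lt_one_of_one_lt_of_neg (by linarith) (by
          have : 0 < 1 / a := by positivity
          linarith)⟩, fun x hx hxM => ?_⟩
      have h1 := Real.rpow_le_rpow_of_nonpos (z := -(1/a)) (Real.rpow_pos_of_pos hx (-a)) hxM (by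
          have : 0 < 1 / a := by positivity
          linarith)
      rwa [← Real.rpow_mul hx.le, show -a * -(1/a) = 1 by field_simp, Real.rpow_one] at h1
    refine ⟨_, (key α hα).1, 1 - M ^ (-(1/α')), ⟨by linarith [(key α' hα').1.2], by linarith [(key α' hα').1.1]⟩, ?_⟩
    intro x hx hxR
    have h3 := hpw x hx
    refine ⟨(key α hα).2 x hx.1 (by linarith), ?_⟩
    have := (key α' hα').2 (1 - x) (by linarith [hx.2]) (by linarith)
    linarith

/-- product maps -/
def prodMaps (f : Fin N → ℝ → ℝ) : Fin N × Fin N → ℝ × ℝ → ℝ × ℝ :=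
  fun ij z => (f ij.1 z.1, f ij.2 z.2)

lemma adm_split (h : AdmissibleIFS N f p d e) (a b : ℝ) (ha : a ∈ Set.Ioo (0:ℝ) 1)
    (hb : b ∈ Set.Ioo (0:ℝ) 1) :
    ∃ m : ℕ, ∃ ε > (0:ℝ), ∀ z ∈ (Set.Ioo (0:ℝ) 1 ×ˢ Set.Ioo (0:ℝ) 1), a ≤ z.1 → z.2 ≤ b →
      ε ≤ (avgOp (fun ij : Fin N × Fin N => p ij.1 * p ij.2) (prodMaps f))^[m+1]
        ({z : ℝ × ℝ | z.2 ≤ z.1}.indicator (fun _ => (1:ℝ))) z := by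
  have hne : (Finset.univ : Finset (Fin N)).Nonempty := by
    obtain ⟨i, _⟩ := (h.interior (1/2) (by norm_num)).1
    exact ⟨i, Finset.mem_univ i⟩
  set R : ℝ → ℝ := fun x => Finset.univ.sup' hne (fun i => f i x) with hR
  set Lf : ℝ → ℝ := fun x => Finset.univ.inf' hne (fun i => f i x) with hLf
  have hRi : ∀ x, ∃ i, R x = f i x := fun x => by
    obtain ⟨i, _, hi⟩ := Finset.exists_mem_eq_sup' hne (fun i => f i x); exact ⟨i, hi⟩
  have hLi : ∀ x, ∃ i, Lf x = f i x := fun x => by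
    obtain ⟨i, _, hi⟩ := Finset.exists_mem_eq_inf' hne (fun i => f i x); exact ⟨i, hi⟩
  have hRS : ∀ x ∈ Set.Ioo (0:ℝ) 1, R x ∈ Set.Ioo (0:ℝ) 1 := fun x hx => by
    obtain ⟨i, hi⟩ := hRi x; rw [hi]; exact adm_maps h i x hx
  have hLS : ∀ x ∈ Set.Ioo (0:ℝ) 1, Lf x ∈ Set.Ioo (0:ℝ) 1 := fun x hx => by
    obtain ⟨i, hi⟩ := hLi x; rw [hi]; exact adm_maps h i x hx
  have hRc : ContinuousOn R (Set.Icc 0 1) := ContinuousOn.finset_sup'_apply hne fun i _ => h.cont i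
  have hLc : ContinuousOn Lf (Set.Icc 0 1) := ContinuousOn.finset_inf'_apply hne fun i _ => h.cont i
  have hRlt : ∀ x ∈ Set.Ioo (0:ℝ) 1, x < R x := fun x hx => by
    obtain ⟨i, hi⟩ := (h.interior x hx).2
    exact hi.trans_le (Finset.le_sup' (fun i => f i x) (Finset.mem_univ i))
  have hLlt : ∀ x ∈ Set.Ioo (0:ℝ) 1, Lf x < x := fun x hx => by
    obtain ⟨i, hi⟩ := (h.interior x hx).1
    exact (Finset.inf'_le (fun i => f i x) (Finset.mem_univ i)).trans_lt hi
  have hsub : ∀ x ∈ Set.Ioo (0:ℝ) 1, x ∈ Set.Icc (0:ℝ) 1 := fun x hx => ⟨hx.1.le, hx.2.le⟩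
  have hRm : ∀ x ∈ Set.Ioo (0:ℝ) 1, ∀ y ∈ Set.Ioo (0:ℝ) 1, x ≤ y → R x ≤ R y := fun x hx y hy hxy =>
    Finset.sup'_le hne _ fun i hi => ((h.mono i).monotoneOn (hsub x hx) (hsub y hy) hxy).trans
      (Finset.le_sup' (fun i => f i y) hi)
  have hLm : ∀ x ∈ Set.Ioo (0:ℝ) 1, ∀ y ∈ Set.Ioo (0:ℝ) 1, x ≤ y → Lf x ≤ Lf y := fun x hx y hy hxy =>
    Finset.le_inf' hne _ fun i hi => (Finset.inf'_le (fun i => f i x) hi).trans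
      ((h.mono i).monotoneOn (hsub x hx) (hsub y hy) hxy)
  have hitm : ∀ G : ℝ → ℝ, (∀ x ∈ Set.Ioo (0:ℝ) 1, G x ∈ Set.Ioo (0:ℝ) 1) →
      (∀ x ∈ Set.Ioo (0:ℝ) 1, ∀ y ∈ Set.Ioo (0:ℝ) 1, x ≤ y → G x ≤ G y) → ∀ m : ℕ,
      ∀ x ∈ Set.Ioo (0:ℝ) 1, ∀ y ∈ Set.Ioo (0:ℝ) 1, x ≤ y → G^[m] x ≤ G^[m] y := by
    intro G h1 h2 m
    induction m with
    | zero => intro x _ y _ hxy; simpa using hxy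
    | succ m ih =>
      intro x hx y hy hxy
      simp only [Function.iterate_succ_apply]
      exact ih _ (h1 x hx) _ (h1 y hy) (h2 x hx y hy hxy)
  have ev := ((reach_right R hRc hRS hRlt a ha).and (reach_left Lf hLc hLS hLlt b hb)).and
    (eventually_ge_atTop 1)
  obtain ⟨m', ⟨hm1, hm2⟩, hm3⟩ := ev.exists
  obtain ⟨m, rfl⟩ : ∃ m, m' = m + 1 := ⟨m' - 1, by omega⟩
  obtain ⟨i0, -, hi0⟩ := Finset.exists_min_image Finset.univ p hne
  set q := p i0 * p i0 with hq
  have hq0 : 0 < q := mul_pos (h.ppos i0) (h.ppos i0)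
  refine ⟨m, q ^ (m+1), by positivity, ?_⟩
  intro z hz haz hzb
  have hsum : ∑ ij : Fin N × Fin N, p ij.1 * p ij.2 = 1 := by
    rw [Fintype.sum_prod_type]
    simp only [← Finset.mul_sum, h.psum, mul_one]
  have low := avgOp_lower (p := fun ij : Fin N × Fin N => p ij.1 * p ij.2) (F := prodMaps f)
    (S := Set.Ioo (0:ℝ) 1 ×ˢ Set.Ioo (0:ℝ) 1)
    hsum (fun ij => (mul_pos (h.ppos ij.1) (h.ppos ij.2)).le)
    (fun ij x hx => ⟨adm_maps h ij.1 _ hx.1, adm_maps h ij.2 _ hx.2⟩)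
    (g := {z : ℝ × ℝ | z.2 ≤ z.1}.indicator (fun _ => (1:ℝ)))
    (fun x _ => Set.indicator_nonneg (fun _ _ => zero_le_one) x) hq0.le
    (fun ij => mul_le_mul (hi0 _ (Finset.mem_univ _)) (hi0 _ (Finset.mem_univ _)) (h.ppos i0).le
      (h.ppos ij.1).le)
    (fun z => (R z.1, Lf z.2)) (fun z => by
      obtain ⟨i, hi⟩ := hRi z.1
      obtain ⟨j, hj⟩ := hLi z.2
      exact ⟨(i, j), by simp [prodMaps, hi, hj]⟩) (m+1) z hz
  have hit : (fun z : ℝ × ℝ => (R z.1, Lf z.2))^[m+1] z = (R^[m+1] z.1, Lf^[m+1] z.2) := by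
    have := Prod.map_iterate R Lf (m+1)
    exact congrFun this z
  rw [hit, Set.indicator_of_mem, mul_one] at low
  · exact low
  · show Lf^[m+1] z.2 ≤ R^[m+1] z.1
    have h1 := hitm R hRS hRm (m+1) a ha z.1 hz.1 haz
    have h2 := hitm Lf hLS hLm (m+1) z.2 hz.2 b hb hzb
    linarith

end adm

section fin
variable {N : ℕ} {f : Fin N → ℝ → ℝ} {p d e : Fin N → ℝ}

lemma prod_avg (hp1 : ∑ i, p i = 1) (g k : ℝ → ℝ) :
    avgOp (fun ij : Fin N × Fin N => p ij.1 * p ij.2) (prodMaps f) (fun z => g z.1 + k z.2) =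
      fun z => transferOp f p g z.1 + transferOp f p k z.2 := by
  funext z
  simp only [avgOp, prodMaps, transferOp, Fintype.sum_prod_type, mul_add, Finset.sum_add_distrib]
  congr 1
  · refine Finset.sum_congr rfl fun i _ => ?_
    rw [← Finset.sum_mul, ← Finset.mul_sum, hp1, mul_one]
  · simp only [mul_assoc]
    simp only [← Finset.mul_sum]
    rw [← Finset.sum_mul, hp1, one_mul]

lemma iter_id (h : AdmissibleIFS N f p d e) (n : ℕ) :
    (∀ x ∈ Set.Icc (0:ℝ) 1, (transferOp f p)^[n] id x ∈ Set.Icc (0:ℝ) 1) ∧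
    MonotoneOn ((transferOp f p)^[n] id) (Set.Icc 0 1) := by
  induction n with
  | zero => exact ⟨fun x hx => by simpa using hx, fun x _ y _ hxy => by simpa using hxy⟩
  | succ n ih =>
    rw [Function.iterate_succ_apply']
    refine ⟨fun x hx => ⟨?_, ?_⟩, fun x hx y hy hxy => ?_⟩
    · exact Finset.sum_nonneg fun i _ => mul_nonneg (h.ppos i).le (ih.1 _ (h.maps i hx)).1
    · rw [← h.psum]
      exact Finset.sum_le_sum fun i _ => mul_le_of_le_one_right (h.ppos i).le (ih.1 _ (h.maps i hx)).2
    · exact Finset.sum_le_sum fun i _ => mul_le_mul_of_nonneg_left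
        (ih.2 (h.maps i hx) (h.maps i hy) ((h.mono i).monotoneOn hx hy hxy)) (h.ppos i).le

lemma iter_lip (h : AdmissibleIFS N f p d e) (φ : ℝ → ℝ) (L : ℝ)
    (hφ : ∀ a ∈ Set.Icc (0:ℝ) 1, ∀ b ∈ Set.Icc (0:ℝ) 1, |φ a - φ b| ≤ L * |a - b|) (n : ℕ) :
    ∀ x ∈ Set.Icc (0:ℝ) 1, ∀ y ∈ Set.Icc (0:ℝ) 1, x ≤ y →
      |(transferOp f p)^[n] φ y - (transferOp f p)^[n] φ x| ≤
        L * ((transferOp f p)^[n] id y - (transferOp f p)^[n] id x) := by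
  induction n with
  | zero =>
    intro x hx y hy hxy
    have := hφ y hy x hx
    rw [abs_of_nonneg (sub_nonneg.2 hxy)] at this
    simpa using this
  | succ n ih =>
    intro x hx y hy hxy
    simp only [Function.iterate_succ_apply']
    unfold transferOp
    rw [← Finset.sum_sub_distrib, ← Finset.sum_sub_distrib, Finset.mul_sum]
    refine (Finset.abs_sum_le_sum_abs _ _).trans (Finset.sum_le_sum fun i _ => ?_)
    rw [← mul_sub, ← mul_sub, abs_mul, abs_of_pos (h.ppos i)]
    have := mul_le_mul_of_nonneg_left (ih _ (h.maps i hx) _ (h.maps i hy)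
      ((h.mono i).monotoneOn hx hy hxy)) (h.ppos i).le
    unfold transferOp at this
    linarith

lemma adm_contr (h : AdmissibleIFS N f p d e) {V : ℝ → ℝ}
    (hV0 : ∀ x ∈ Set.Ioo (0:ℝ) 1, 0 ≤ V x) {l K : ℝ} (hl : 0 < l) (hl1 : l < 1) (hK : 0 < K)
    (hd : ∀ x ∈ Set.Ioo (0:ℝ) 1, transferOp f p V x ≤ l * V x + K)
    (hR : ∀ R : ℝ, ∃ a ∈ Set.Ioo (0:ℝ) 1, ∃ b ∈ Set.Ioo (0:ℝ) 1, ∀ x ∈ Set.Ioo (0:ℝ) 1,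
        V x ≤ R → a ≤ x ∧ x ≤ b) :
    ∃ C > (0:ℝ), ∃ s : ℝ, 0 < s ∧ s < 1 ∧ ∀ n : ℕ, ∀ x ∈ Set.Ioo (0:ℝ) 1, ∀ y ∈ Set.Ioo (0:ℝ) 1,
      (transferOp f p)^[n] id y - (transferOp f p)^[n] id x ≤ C * s ^ n * (1 + (V x + V y)) := by
  have hsum : ∑ ij : Fin N × Fin N, p ij.1 * p ij.2 = 1 := by
    rw [Fintype.sum_prod_type]
    simp only [← Finset.mul_sum, h.psum, mul_one]
  have hsub : ∀ x ∈ Set.Ioo (0:ℝ) 1, x ∈ Set.Icc (0:ℝ) 1 := fun x hx => ⟨hx.1.le, hx.2.le⟩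
  obtain ⟨C, hC, s, hs, hs1, H⟩ := contraction_abs
    (p := fun ij : Fin N × Fin N => p ij.1 * p ij.2) (F := prodMaps f)
    (S := Set.Ioo (0:ℝ) 1 ×ˢ Set.Ioo (0:ℝ) 1) (A := {z : ℝ × ℝ | z.2 ≤ z.1})
    (fun ij => (mul_pos (h.ppos ij.1) (h.ppos ij.2)).le) hsum
    (fun ij x hx => ⟨adm_maps h ij.1 _ hx.1, adm_maps h ij.2 _ hx.2⟩)
    (V := fun z => V z.1 + V z.2) (l := l) (K := 2 * K) hl hl1 (by linarith)
    (fun z hz => add_nonneg (hV0 _ hz.1) (hV0 _ hz.2))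
    (fun z hz => by
      rw [prod_avg h.psum]
      have h1 := hd _ hz.1
      have h2 := hd _ hz.2
      simp only
      linarith)
    (fun n z => (fun x => - (transferOp f p)^[n] id x) z.1 + (transferOp f p)^[n] id z.2)
    (fun n => by
      rw [prod_avg h.psum (fun x => - (transferOp f p)^[n] id x) ((transferOp f p)^[n] id)]
      funext z
      simp [Function.iterate_succ_apply', transferOp])
    (fun n z hz hA => by
      have := (iter_id h n).2 (hsub _ hz.2) (hsub _ hz.1) hA
      simp only; linarith)
    (fun n z hz => by
      have h1 := (iter_id h n).1 _ (hsub _ hz.1)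
      have h2 := (iter_id h n).1 _ (hsub _ hz.2)
      simp only; linarith [h1.1, h2.2])
    (fun R => by
      obtain ⟨a, ha, b, hb, hab⟩ := hR R
      obtain ⟨m, ε, hε, H⟩ := adm_split h a b ha hb
      refine ⟨m, ε, hε, fun z hz hzR => H z hz ?_ ?_⟩
      · exact (hab z.1 hz.1 (by linarith [hV0 _ hz.2])).1
      · exact (hab z.2 hz.2 (by linarith [hV0 _ hz.1])).2)
  refine ⟨C, hC, s, hs, hs1, fun n x hx y hy => ?_⟩
  have := H n (x, y) ⟨hx, hy⟩
  simp only at this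
  linarith

lemma inv_int (h : AdmissibleIFS N f p d e)
    (μ : Measure ℝ) (hprob : IsProbabilityMeasure μ)
    (hae : ∀ᵐ x ∂μ, x ∈ Set.Ioo (0:ℝ) 1)
    (hinv : (∑ i, ENNReal.ofReal (p i) • Measure.map (f i) μ) = μ)
    (g : ℝ → ℝ) (hg : Measurable g) (B : ℝ) (hB : ∀ x ∈ Set.Ioo (0:ℝ) 1, |g x| ≤ B) :
    Integrable g μ ∧ Integrable (transferOp f p g) μ ∧ ∫ x, transferOp f p g x ∂μ = ∫ x, g x ∂μ := by
  have hi : ∀ i, Integrable (fun x => g (f i x)) μ := fun i =>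
    Integrable.of_bound (hg.comp (h.meas i)).aestronglyMeasurable B
      (hae.mono fun x hx => hB _ (adm_maps h i x hx))
  have hgi : Integrable g μ := Integrable.of_bound hg.aestronglyMeasurable B
      (hae.mono fun x hx => hB _ hx)
  have hU : Integrable (transferOp f p g) μ := integrable_finsetSum _ fun i _ => (hi i).const_mul _
  refine ⟨hgi, hU, ?_⟩
  have e1 : ∫ x, g x ∂μ = ∑ i, p i * ∫ x, g (f i x) ∂μ := by
    conv_lhs => rw [← hinv]
    rw [integral_finsetSum_measure]
    · refine Finset.sum_congr rfl fun i _ => ?_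
      rw [integral_smul_measure, integral_map (h.meas i).aemeasurable hg.aestronglyMeasurable,
        ENNReal.toReal_ofReal (h.ppos i).le, smul_eq_mul]
    · intro i _
      apply Integrable.smul_measure _ ENNReal.ofReal_ne_top
      rw [integrable_map_measure hg.aestronglyMeasurable (h.meas i).aemeasurable]
      exact hi i
  rw [e1]
  unfold transferOp
  rw [integral_finsetSum _ fun i _ => (hi i).const_mul _]
  simp only [integral_const_mul]

lemma V_integrable (h : AdmissibleIFS N f p d e)
    (μ : Measure ℝ) (hprob : IsProbabilityMeasure μ)
    (hae : ∀ᵐ x ∂μ, x ∈ Set.Ioo (0:ℝ) 1)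
    (hinv : (∑ i, ENNReal.ofReal (p i) • Measure.map (f i) μ) = μ)
    {V : ℝ → ℝ} (hVm : Measurable V)
    (hV0 : ∀ x ∈ Set.Ioo (0:ℝ) 1, 0 ≤ V x) {l K : ℝ} (hl : 0 < l) (hl1 : l < 1) (hK : 0 < K)
    (hd : ∀ x ∈ Set.Ioo (0:ℝ) 1, transferOp f p V x ≤ l * V x + K) :
    Integrable V μ := by
  set G : ℕ → ℝ → ℝ := fun M x => min (V x) M - min (l * V x + K) M + K with hG
  have hGm : ∀ M, Measurable (G M) := fun M => by
    have : Measurable fun x => l * V x + K := (hVm.const_mul l).add_const K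
    exact ((hVm.min measurable_const).sub (this.min measurable_const)).add_const K
  have hGnn : ∀ M : ℕ, ∀ x ∈ Set.Ioo (0:ℝ) 1, 0 ≤ G M x := by
    intro M x hx
    have h0 := hV0 x hx
    have : min (l * V x + K) M ≤ min (V x) M + K := by
      rcases le_total (V x) M with hm | hm
      · rw [min_eq_left hm]; exact (min_le_left _ _).trans (by nlinarith)
      · rw [min_eq_right hm]; exact (min_le_right _ _).trans (by linarith)
    simp only [hG]; linarith
  have hGi : ∀ M : ℕ, ∫⁻ x, ENNReal.ofReal (G M x) ∂μ ≤ ENNReal.ofReal K := by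
    intro M
    have hM : (0:ℝ) ≤ M := Nat.cast_nonneg M
    have h1 := inv_int h μ hprob hae hinv (fun x => min (V x) M) (hVm.min measurable_const) M
      (fun x hx => by rw [abs_of_nonneg (le_min (hV0 x hx) hM)]; exact min_le_right _ _)
    have h2 : Integrable (fun x => min (l * V x + K) M) μ :=
      Integrable.of_bound (((hVm.const_mul l).add_const K).min measurable_const).aestronglyMeasurable M
        (hae.mono fun x hx => by
          have := hV0 x hx
          rw [Real.norm_eq_abs, abs_of_nonneg (le_min (by positivity) hM)]; exact min_le_right _ _)
    have h3 : ∫ x, min (V x) M ∂μ ≤ ∫ x, min (l * V x + K) M ∂μ := by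
      rw [← h1.2.2]
      refine integral_mono_ae h1.2.1 h2 (hae.mono fun x hx => le_min ?_ ?_)
      · refine le_trans (Finset.sum_le_sum fun i _ => ?_) (hd x hx)
        exact mul_le_mul_of_nonneg_left (min_le_left _ _) (h.ppos i).le
      · calc transferOp f p (fun x => min (V x) M) x ≤ ∑ i, p i * (M:ℝ) :=
            Finset.sum_le_sum fun i _ => mul_le_mul_of_nonneg_left (min_le_right _ _) (h.ppos i).le
          _ = M := by rw [← Finset.sum_mul, h.psum, one_mul]
    have hGint : Integrable (G M) μ := (h1.1.sub h2).add (integrable_const K)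
    rw [← ofReal_integral_eq_lintegral_ofReal hGint (hae.mono fun x hx => hGnn M x hx)]
    apply ENNReal.ofReal_le_ofReal
    have : ∫ x, G M x ∂μ = ∫ x, min (V x) M ∂μ - ∫ x, min (l * V x + K) M ∂μ + K := by
      simp only [hG]
      rw [integral_add (f := fun x => min (V x) M - min (l * V x + K) M) (h1.1.sub h2) (integrable_const K),
        integral_sub h1.1 h2]
      simp
    linarith
  have hF := lintegral_liminf_le (u := atTop) (μ := μ) (f := fun M x => ENNReal.ofReal (G M x))
    (fun M => (hGm M).ennreal_ofReal)
  have hlim : ∀ x, liminf (fun M => ENNReal.ofReal (G M x)) atTop = ENNReal.ofReal ((1 - l) * V x) := by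
    intro x
    apply Tendsto.liminf_eq
    apply tendsto_const_nhds.congr'
    filter_upwards [eventually_ge_atTop ⌈max (V x) (l * V x + K)⌉₊] with M hM
    have h1 : max (V x) (l * V x + K) ≤ M := (Nat.le_ceil _).trans (by exact_mod_cast hM)
    simp only [hG]
    rw [min_eq_left ((le_max_left _ _).trans h1), min_eq_left ((le_max_right _ _).trans h1)]
    congr 1; ring
  simp only [hlim] at hF
  have hle : liminf (fun M => ∫⁻ x, ENNReal.ofReal (G M x) ∂μ) atTop ≤ ENNReal.ofReal K := by
    refine (liminf_le_liminf (Eventually.of_forall hGi)).trans ?_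
    simp
  have h4 : Integrable (fun x => (1 - l) * V x) μ := by
    refine ⟨(hVm.const_mul _).aestronglyMeasurable, ?_⟩
    rw [hasFiniteIntegral_iff_ofReal (hae.mono fun x hx => mul_nonneg (by linarith) (hV0 x hx))]
    exact (hF.trans hle).trans_lt ENNReal.ofReal_lt_top
  have h5 := h4.const_mul (1 - l)⁻¹
  have : (1 - l) ≠ 0 := by linarith
  simpa [← mul_assoc, this] using h5

end fin

lemma iter_facts {N : ℕ} {f : Fin N → ℝ → ℝ} {p d e : Fin N → ℝ} (h : AdmissibleIFS N f p d e)
    (μ : Measure ℝ) (hprob : IsProbabilityMeasure μ)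
    (hae : ∀ᵐ x ∂μ, x ∈ Set.Ioo (0:ℝ) 1)
    (hinv : (∑ i, ENNReal.ofReal (p i) • Measure.map (f i) μ) = μ)
    (φ : ℝ → ℝ) (hφ : Measurable φ) (B : ℝ) (hB : ∀ x ∈ Set.Ioo (0:ℝ) 1, |φ x| ≤ B)
    (h0 : ∫ x, φ x ∂μ = 0) (j : ℕ) :
    Measurable ((transferOp f p)^[j] φ) ∧ (∀ x ∈ Set.Ioo (0:ℝ) 1, |(transferOp f p)^[j] φ x| ≤ B) ∧
      ∫ x, (transferOp f p)^[j] φ x ∂μ = 0 := by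
  induction j with
  | zero => exact ⟨hφ, hB, h0⟩
  | succ j ih =>
    rw [Function.iterate_succ_apply']
    obtain ⟨a, b, c⟩ := ih
    refine ⟨?_, fun x hx => ?_, ?_⟩
    · unfold transferOp at a ⊢
      exact Finset.measurable_sum _ fun i _ => (a.comp (h.meas i)).const_mul _
    · calc |transferOp f p ((transferOp f p)^[j] φ) x| ≤ ∑ i, p i * B := by
            refine (Finset.abs_sum_le_sum_abs _ _).trans (Finset.sum_le_sum fun i _ => ?_)
            rw [abs_mul, abs_of_pos (h.ppos i)]
            exact mul_le_mul_of_nonneg_left (b _ (adm_maps h i x hx)) (h.ppos i).le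
        _ = B := by rw [← Finset.sum_mul, h.psum, one_mul]
    · rw [(inv_int h μ hprob hae hinv _ a B b).2.2, c]

/-- For an admissible system with invariant measure `μ*` on `(0,1)`
and a Lipschitz `φ` with `∫ φ dμ* = 0`, one has `‖∑_{j=1}^n Uʲφ‖_{L²(μ*)} ≤ C n^{3/8}`;
in particular the Maxwell–Woodroofe condition holds. -/
theorem stmt16 (N : ℕ) (f : Fin N → ℝ → ℝ) (p d e : Fin N → ℝ)
    (hadm : AdmissibleIFS N f p d e)
    (μstar : Measure ℝ) (hprob : IsProbabilityMeasure μstar)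
    (hμ01 : μstar (Ioo (0:ℝ) 1) = 1)
    (hinv : (∑ i, ENNReal.ofReal (p i) • Measure.map (f i) μstar) = μstar)
    (φ : ℝ → ℝ) (L : ℝ) (hL : 0 ≤ L) (hφmeas : Measurable φ)
    (hφ : ∀ a ∈ Icc (0:ℝ) 1, ∀ b ∈ Icc (0:ℝ) 1, |φ a - φ b| ≤ L * |a - b|)
    (hφ0 : ∫ x, φ x ∂μstar = 0) :
    ∃ C > (0:ℝ),
      (∀ n : ℕ,
        eLpNorm (fun x => ∑ j ∈ Finset.Icc 1 n, (transferOp f p)^[j] φ x) 2 μstar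
          ≤ ENNReal.ofReal (C * (n : ℝ) ^ ((3 : ℝ) / 8))) ∧
      Summable (fun n : ℕ => (n : ℝ) ^ (-(3 : ℝ) / 2) *
        (eLpNorm (fun x => ∑ j ∈ Finset.Icc 1 n, (transferOp f p)^[j] φ x) 2 μstar).toReal) := by
  have hae : ∀ᵐ x ∂μstar, x ∈ Set.Ioo (0:ℝ) 1 := by
    rw [← prob_compl_eq_zero_iff measurableSet_Ioo] at hμ01
    exact hμ01
  have hsub : ∀ x ∈ Set.Ioo (0:ℝ) 1, x ∈ Set.Icc (0:ℝ) 1 := fun x hx => ⟨hx.1.le, hx.2.le⟩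
  obtain ⟨V, hVm, hV0, ⟨l, K, hl, hl1, hK, hd⟩, hR⟩ := adm_drift hadm
  obtain ⟨C, hC, s, hs, hs1, hcon⟩ := adm_contr hadm hV0 hl hl1 hK hd hR
  have hVi := V_integrable hadm μstar hprob hae hinv hVm hV0 hl hl1 hK hd
  have hfacts := iter_facts hadm μstar hprob hae hinv φ hφmeas (|φ 0| + L) (fun x hx => by
    have h1 := hφ x (hsub x hx) 0 (by simp)
    rw [sub_zero, abs_of_pos hx.1] at h1
    have h2 := abs_sub_abs_le_abs_sub (φ x) (φ 0)
    have h3 : L * x ≤ L := mul_le_of_le_one_right hL hx.2.le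
    linarith) hφ0
  set W : ℝ → ℝ := fun x => Real.sqrt (V x) with hW
  have hWm : Measurable W := hVm.sqrt
  have hW2 : MemLp W 2 μstar := by
    rw [memLp_two_iff_integrable_sq hWm.aestronglyMeasurable]
    refine hVi.congr (hae.mono fun x hx => ?_)
    simp only [hW]; rw [Real.sq_sqrt (hV0 x hx)]
  have hWi : Integrable W μstar := hW2.integrable (by norm_num)
  have hWn : ∀ x, 0 ≤ W x := fun x => Real.sqrt_nonneg _
  set t := Real.sqrt s with ht
  have ht0 : 0 < t := Real.sqrt_pos.2 hs
  have ht1 : t < 1 := by rw [ht, Real.sqrt_lt' one_pos]; simpa using hs1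
  set c := Real.sqrt C with hc
  have hc0 : 0 < c := Real.sqrt_pos.2 hC
  have hpair : ∀ n : ℕ, ∀ x ∈ Set.Ioo (0:ℝ) 1, ∀ y ∈ Set.Ioo (0:ℝ) 1, x ≤ y →
      |(transferOp f p)^[n] φ y - (transferOp f p)^[n] φ x| ≤ L * (c * t ^ n * (1 + W x + W y)) := by
    intro n x hx y hy hxy
    refine (iter_lip hadm φ L hφ n x (hsub x hx) y (hsub y hy) hxy).trans
      (mul_le_mul_of_nonneg_left ?_ hL)
    have h1 := hcon n x hx y hy
    have h2 := (iter_id hadm n).1 x (hsub x hx)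
    have h3 := (iter_id hadm n).1 y (hsub y hy)
    have h4 := (iter_id hadm n).2 (hsub x hx) (hsub y hy) hxy
    set D := (transferOp f p)^[n] id y - (transferOp f p)^[n] id x with hDdef
    have hD0 : 0 ≤ D := by linarith
    have hD1 : D ≤ 1 := by linarith [h2.1, h3.2]
    apply le_of_sq_le_sq _ (by have := hWn x; have := hWn y; positivity)
    have e1 : (c * t ^ n * (1 + W x + W y)) ^ 2 = C * s ^ n * (1 + W x + W y) ^ 2 := by
      rw [mul_pow, mul_pow, ← pow_mul, mul_comm n 2, pow_mul, hc, ht, Real.sq_sqrt hC.le,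
        Real.sq_sqrt hs.le]
    rw [e1]
    have e2 : (1 + (V x + V y)) ≤ (1 + W x + W y) ^ 2 := by
      have a1 : W x ^ 2 = V x := Real.sq_sqrt (hV0 x hx)
      have a2 : W y ^ 2 = V y := Real.sq_sqrt (hV0 y hy)
      nlinarith [hWn x, hWn y, mul_nonneg (hWn x) (hWn y)]
    calc D ^ 2 ≤ D := by nlinarith
      _ ≤ _ := h1
      _ ≤ _ := by gcongr
  set w := ∫ y, W y ∂μstar with hw
  have hw0 : 0 ≤ w := integral_nonneg hWn
  have hpt : ∀ n : ℕ, ∀ x ∈ Set.Ioo (0:ℝ) 1,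
      |(transferOp f p)^[n] φ x| ≤ L * c * (1 + W x + w) * t ^ n := by
    intro n x hx
    obtain ⟨hm, hb, hz⟩ := hfacts n
    have hi := (inv_int hadm μstar hprob hae hinv _ hm _ hb).1
    have e1 : (transferOp f p)^[n] φ x =
        ∫ y, ((transferOp f p)^[n] φ x - (transferOp f p)^[n] φ y) ∂μstar := by
      rw [integral_sub (integrable_const _) hi, hz]; simp
    have hbi : Integrable (fun y => L * (c * t ^ n * (1 + W x + W y))) μstar :=
      (((integrable_const (1 + W x)).add hWi).const_mul _).const_mul _
    have e2 : ∫ y, L * (c * t ^ n * (1 + W x + W y)) ∂μstar = L * c * (1 + W x + w) * t ^ n := by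
      rw [integral_const_mul, integral_const_mul, integral_add (integrable_const _) hWi]
      simp; ring
    rw [← e2, e1, ← Real.norm_eq_abs]
    refine norm_integral_le_of_norm_le hbi (hae.mono fun y hy => ?_)
    rw [Real.norm_eq_abs]
    rcases le_total x y with hxy | hxy
    · rw [abs_sub_comm]; exact hpair n x hx y hy hxy
    · have := hpair n y hy x hx hxy
      rwa [add_right_comm] at this
  set g : ℝ → ℝ := fun x => L * c * (1 - t)⁻¹ * (W x + (1 + w)) with hg
  have hgL : MemLp g 2 μstar := (hW2.add (memLp_const (1 + w))).const_mul _
  have hsum : ∀ n : ℕ, eLpNorm (fun x => ∑ j ∈ Finset.Icc 1 n, (transferOp f p)^[j] φ x) 2 μstar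
      ≤ eLpNorm g 2 μstar := by
    intro n
    refine eLpNorm_mono_ae_real (hae.mono fun x hx => ?_)
    have hWx := hWn x
    calc ‖∑ j ∈ Finset.Icc 1 n, (transferOp f p)^[j] φ x‖
        ≤ ∑ j ∈ Finset.Icc 1 n, L * c * (1 + W x + w) * t ^ j := by
          refine (Finset.abs_sum_le_sum_abs _ _).trans (Finset.sum_le_sum fun j _ => hpt j x hx)
      _ = L * c * (1 + W x + w) * ∑ j ∈ Finset.Icc 1 n, t ^ j := by rw [Finset.mul_sum]
      _ ≤ L * c * (1 + W x + w) * (1 - t)⁻¹ := by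
          apply mul_le_mul_of_nonneg_left _ (by positivity)
          exact sum_le_hasSum _ (fun j _ => by positivity) (hasSum_geometric_of_lt_one ht0.le ht1)
      _ = g x := by simp only [hg]; ring
  set C0 := (eLpNorm g 2 μstar).toReal + 1 with hC0
  have hC00 : 0 < C0 := by positivity
  have hgle : eLpNorm g 2 μstar ≤ ENNReal.ofReal C0 := by
    rw [ENNReal.le_ofReal_iff_toReal_le hgL.eLpNorm_ne_top hC00.le]; linarith
  refine ⟨C0, hC00, fun n => ?_, ?_⟩
  · rcases Nat.eq_zero_or_pos n with rfl | hn
    · simp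
    · refine (hsum n).trans (hgle.trans (ENNReal.ofReal_le_ofReal ?_))
      have : (1:ℝ) ≤ (n:ℝ) ^ ((3:ℝ)/8) := Real.one_le_rpow (by exact_mod_cast hn) (by norm_num)
      nlinarith
  · have hb : Summable fun n : ℕ => (n:ℝ) ^ (-(3:ℝ)/2) * C0 :=
      (Real.summable_nat_rpow.2 (by norm_num)).mul_right _
    refine Summable.of_nonneg_of_le (fun n => by positivity) (fun n => ?_) hb
    apply mul_le_mul_of_nonneg_left _ (by positivity)
    exact ENNReal.toReal_le_of_le_ofReal hC00.le ((hsum n).trans hgle)
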